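/- Let K be an algebraically closed field of characteristic 3 and let d ≥ 4 be an integer with d ≡ 1 (mod 3) and d ≢ 1 (mod 9). Let g ∈ K[x] be a monic polynomial of degree d. Then there exist β ∈ K, a polynomial h ∈ K[x] with deg h ≤ (d−1)/3, an element a ∈ K, and a polynomial F ∈ K[x] such that g(x+β) − h(x)³ + h(x) = x^d + a·x^{d−2} + F(x), where F = 0 if d = 4, and otherwise deg F ≤ d−5 and the coefficient of x^i in F is zero whenever 3 divides i. -/

import Mathlib

open Polynomial

/-- Artin–Schreier reduction in characteristic `3`: adding `h - h ^ 3` kills all coefficients at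
multiples of `3` without changing the other coefficients of large index. -/
theorem exists_artinSchreier_reduction {K : Type*} [Field K] [IsAlgClosed K] [CharP K 3]
    (n : ℕ) (G : K[X]) (hG : ∀ i, n < i → G.coeff (3 * i) = 0) :
    ∃ h : K[X], h.natDegree ≤ n ∧ (∀ i, (G - h ^ 3 + h).coeff (3 * i) = 0) ∧
      ∀ j, n < j → ¬ 3 ∣ j → (G - h ^ 3 + h).coeff j = G.coeff j := by
  have : Fact (Nat.Prime 3) := ⟨Nat.prime_three⟩
  induction n generalizing G with
  | zero =>
    obtain ⟨e, he⟩ : ∃ e : K, e ^ 3 - e - G.coeff 0 = 0 := by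
      have hdeg : (X ^ 3 - X - C (G.coeff 0) : K[X]).degree = 3 := by compute_degree!
      obtain ⟨e, he⟩ := IsAlgClosed.exists_root (X ^ 3 - X - C (G.coeff 0) : K[X])
        (by rw [hdeg]; decide)
      exact ⟨e, by simpa using he⟩
    have hcoeff (j : ℕ) (hj : j ≠ 0) : (G - C e ^ 3 + C e).coeff j = G.coeff j := by
      rw [← C_pow, coeff_add, coeff_sub, coeff_C_of_ne_zero hj, coeff_C_of_ne_zero hj]
      simp
    refine ⟨C e, by simp, fun i => ?_, fun j hj _ => hcoeff j hj.ne'⟩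
    rcases Nat.eq_zero_or_pos i with rfl | hi
    · rw [← C_pow]
      simp only [mul_zero, coeff_add, coeff_sub, coeff_C_zero]
      linear_combination -he
    · rw [hcoeff _ (by lia), hG i hi]
  | succ n ih =>
    obtain ⟨c, hc⟩ := IsAlgClosed.exists_pow_nat_eq (G.coeff (3 * (n + 1))) (n := 3) (by norm_num)
    have hcoeff (j : ℕ) : (G - C (c ^ 3) * X ^ (3 * (n + 1)) + C c * X ^ (n + 1)).coeff j =
        G.coeff j - (if j = 3 * (n + 1) then c ^ 3 else 0) + if j = n + 1 then c else 0 := by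
      simp only [coeff_add, coeff_sub, coeff_C_mul_X_pow]
    obtain ⟨h, hdeg, hmul, hother⟩ :=
      ih (G - C (c ^ 3) * X ^ (3 * (n + 1)) + C c * X ^ (n + 1)) (by
        intro i hi
        rw [hcoeff, if_neg (by lia : 3 * i ≠ n + 1)]
        rcases eq_or_ne i (n + 1) with rfl | hne
        · simp [hc]
        · rw [if_neg (by lia), hG i (by lia)]
          simp)
    have key : G - (h + C c * X ^ (n + 1)) ^ 3 + (h + C c * X ^ (n + 1)) =
        G - C (c ^ 3) * X ^ (3 * (n + 1)) + C c * X ^ (n + 1) - h ^ 3 + h := by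
      rw [add_pow_char, C_pow]
      ring
    refine ⟨h + C c * X ^ (n + 1), ?_, fun i => by rw [key]; exact hmul i, fun j hj h3 => ?_⟩
    · exact natDegree_add_le_of_degree_le (by lia) (natDegree_C_mul_X_pow_le _ _)
    · rw [key, hother j (by lia) h3, hcoeff, if_neg (by lia), if_neg (by lia)]
      simp

theorem not_three_dvd_choose_three {d : ℕ} (hd3 : d % 3 = 1) (hd9 : d % 9 ≠ 1) :
    ¬ 3 ∣ d.choose 3 := by
  rintro ⟨k, hk⟩
  obtain ⟨m, rfl⟩ : ∃ m, d = 3 * m + 1 := ⟨d / 3, by lia⟩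
  have h := Nat.descFactorial_eq_factorial_mul_choose (3 * m + 1) 3
  rcases Nat.eq_zero_or_pos m with rfl | hm
  · simp at hd9
  obtain ⟨l, rfl⟩ : ∃ l, m = l + 1 := ⟨m - 1, by lia⟩
  rw [hk] at h
  simp only [Nat.descFactorial_succ, Nat.descFactorial_zero, Nat.factorial] at h
  rw [show 3 * (l + 1) + 1 - 2 = 3 * l + 2 by lia, show 3 * (l + 1) + 1 - 1 = 3 * l + 3 by lia] at h
  have h' : (3 * l + 2) * ((l + 1) * (3 * l + 4)) = 3 * (2 * k) := by
    norm_num at h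
    nlinarith
  have h3 : 3 ∣ (3 * l + 2) * ((l + 1) * (3 * l + 4)) := ⟨_, h'⟩
  rw [Nat.prime_three.dvd_mul, Nat.prime_three.dvd_mul] at h3
  lia

/-- A translation and an Artin–Schreier reduction that also kill the coefficient at `d - 3`. -/
theorem exists_translation_reduction {K : Type*} [Field K] [IsAlgClosed K] [CharP K 3]
    {d : ℕ} (hd4 : 4 ≤ d) (hd3 : d % 3 = 1) (hd9 : d % 9 ≠ 1)
    {g : K[X]} (hg : g.Monic) (hgdeg : g.natDegree = d) :
    ∃ (β : K) (h : K[X]), h.natDegree ≤ (d - 1) / 3 ∧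
      (∀ i, (taylor β g - h ^ 3 + h).coeff (3 * i) = 0) ∧
      (taylor β g - h ^ 3 + h).coeff (d - 3) = 0 ∧
      ∀ j, d - 3 < j → ¬ 3 ∣ j →
        (taylor β g - h ^ 3 + h).coeff j = (taylor β g).coeff j := by
  have : Fact (Nat.Prime 3) := ⟨Nat.prime_three⟩
  have hgd : g.coeff d = 1 := by rw [← hgdeg]; exact hg
  have hchoose : ((d.choose 3 : ℕ) : K) ≠ 0 := by
    rw [Ne, CharP.cast_eq_zero_iff K 3]
    exact not_three_dvd_choose_three hd3 hd9
  have hdeg : 3 ≤ (hasseDeriv (d - 3) g).natDegree := by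
    apply le_natDegree_of_ne_zero
    rw [hasseDeriv_coeff, show 3 + (d - 3) = d by lia, hgd, mul_one,
      Nat.choose_symm (by lia : 3 ≤ d)]
    exact hchoose
  rcases hd4.eq_or_lt with rfl | hd
  · have hq : ((hasseDeriv 1 g).comp (X ^ 3 - C (g.coeff 3)) + X).degree ≠ 0 := by
      have hcomp : ((hasseDeriv 1 g).comp (X ^ 3 - C (g.coeff 3))).natDegree =
          (hasseDeriv 1 g).natDegree * 3 := by
        rw [natDegree_comp, natDegree_X_pow_sub_C]
      have hlt : (X : K[X]).natDegree <
          ((hasseDeriv 1 g).comp (X ^ 3 - C (g.coeff 3))).natDegree := by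
        rw [hcomp, natDegree_X]
        simp only [Nat.reduceSub] at hdeg
        lia
      intro h0
      have := natDegree_eq_zero_iff_degree_le_zero.2 h0.le
      rw [natDegree_add_eq_left_of_natDegree_lt hlt] at this
      lia
    obtain ⟨c, hc⟩ := IsAlgClosed.exists_root _ hq
    simp only [IsRoot.def, eval_add, eval_comp, eval_sub, eval_pow, eval_X, eval_C] at hc
    set β := c ^ 3 - g.coeff 3 with hβ
    have h3 : (taylor β g).coeff 3 = c ^ 3 := by
      have hlin : hasseDeriv 3 g = C (1 : K) * X + C (g.coeff 3) := by
        have hle := natDegree_hasseDeriv_le g 3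
        rw [hgdeg] at hle
        rw [eq_X_add_C_of_natDegree_le_one hle, hasseDeriv_coeff, hasseDeriv_coeff]
        have h4 : ((4 : ℕ) : K) = 1 := by
          have := CharP.cast_eq_zero K 3
          push_cast at this ⊢
          linear_combination this
        norm_num [hgd, Nat.choose] at h4 ⊢
        simp [h4]
      rw [taylor_coeff, hlin]
      simp [hβ]
    set G := taylor β g - C (c ^ 3) * X ^ 3 + C c * X with hGdef
    have hcoeff (j : ℕ) : G.coeff j = (taylor β g).coeff j - (if j = 3 then c ^ 3 else 0) +
        if j = 1 then c else 0 := by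
      simp only [hGdef, coeff_add, coeff_sub, coeff_C_mul_X_pow, coeff_C_mul_X]
    obtain ⟨h, hh, hmul, hother⟩ := exists_artinSchreier_reduction 0 G (by
      intro i hi
      rw [hcoeff, if_neg (by lia : 3 * i ≠ 1)]
      rcases eq_or_ne i 1 with rfl | hne
      · simp [h3]
      · rw [if_neg (by lia), coeff_eq_zero_of_natDegree_lt
          (by rw [natDegree_taylor, hgdeg]; lia)]
        simp)
    have key : taylor β g - (h + C c * X) ^ 3 + (h + C c * X) = G - h ^ 3 + h := by
      rw [add_pow_char, hGdef, C_pow]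
      ring
    refine ⟨β, h + C c * X, ?_, fun i => by rw [key]; exact hmul i, ?_, fun j hj h3j => ?_⟩
    · exact natDegree_add_le_of_degree_le (by lia) (by compute_degree)
    · rw [key, hother _ (by lia) (by lia), hcoeff, taylor_coeff]
      simpa using hc
    · rw [key, hother j (by lia) h3j, hcoeff, if_neg (by lia), if_neg (by lia)]
      simp
  · obtain ⟨β, hβ⟩ := IsAlgClosed.exists_root (hasseDeriv (d - 3) g) (by
      intro h0
      have := natDegree_eq_zero_iff_degree_le_zero.2 h0.le
      lia)
    obtain ⟨h, hh, hmul, hother⟩ := exists_artinSchreier_reduction ((d - 1) / 3) (taylor β g) (by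
      intro i hi
      exact coeff_eq_zero_of_natDegree_lt (by rw [natDegree_taylor, hgdeg]; lia))
    refine ⟨β, h, hh, hmul, ?_, fun j hj h3j => hother j (by lia) h3j⟩
    rw [hother _ (by lia) (by lia), taylor_coeff]
    exact hβ

/-- alternative standard form for one pole in characteristic 3
when `d ≡ 1 (mod 3)` and `d ≢ 1 (mod 9)`. -/
theorem stmt3 (K : Type*) [Field K] [IsAlgClosed K] [CharP K 3]
    (d : ℕ) (hd4 : 4 ≤ d) (hd3 : d % 3 = 1) (hd9 : d % 9 ≠ 1)
    (g : K[X]) (hg : g.Monic) (hgdeg : g.natDegree = d) :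
    ∃ (β : K) (h : K[X]) (a : K) (F : K[X]),
      h.natDegree ≤ (d - 1) / 3 ∧
      g.comp (X + C β) - h ^ 3 + h = X ^ d + C a * X ^ (d - 2) + F ∧
      (d = 4 → F = 0) ∧
      (d ≠ 4 → F.degree ≤ (d - 5 : ℕ) ∧ ∀ i : ℕ, 3 ∣ i → F.coeff i = 0) := by
  obtain ⟨β, h, hh, hmul, hd, hother⟩ := exists_translation_reduction hd4 hd3 hd9 hg hgdeg
  simp only [← taylor_apply]
  set R := taylor β g - h ^ 3 + h
  have hcoeff (j : ℕ) : (R - X ^ d - C (R.coeff (d - 2)) * X ^ (d - 2)).coeff j =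
      R.coeff j - (if j = d then 1 else 0) - if j = d - 2 then R.coeff (d - 2) else 0 := by
    simp only [coeff_sub, coeff_C_mul_X_pow, coeff_X_pow]
  have hthree (i : ℕ) (hi : 3 ∣ i) :
      (R - X ^ d - C (R.coeff (d - 2)) * X ^ (d - 2)).coeff i = 0 := by
    obtain ⟨i, rfl⟩ := hi
    rw [hcoeff, hmul, if_neg (by lia), if_neg (by lia)]
    simp
  have hhigh (j : ℕ) (hj : d - 4 ≤ j) :
      (R - X ^ d - C (R.coeff (d - 2)) * X ^ (d - 2)).coeff j = 0 := by
    by_cases h3 : 3 ∣ j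
    · exact hthree j h3
    rw [hcoeff]
    obtain rfl | rfl | rfl | hlt : j = d - 3 ∨ j = d - 2 ∨ j = d ∨ d < j := by lia
    · rw [hd, if_neg (by lia), if_neg (by lia)]
      simp
    · rw [if_neg (by lia)]
      simp
    · have hlead : (taylor β g).coeff j = 1 := by
        rw [← hgdeg, coeff_taylor_natDegree]
        exact hg
      rw [hother j (by lia) h3, hlead, if_neg (by lia : j ≠ j - 2)]
      simp
    · rw [hother j (by lia) h3, coeff_eq_zero_of_natDegree_lt
        (by rw [natDegree_taylor, hgdeg]; exact hlt), if_neg (by lia), if_neg (by lia)]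
      simp
  refine ⟨β, h, R.coeff (d - 2), R - X ^ d - C (R.coeff (d - 2)) * X ^ (d - 2), hh, by simp [R],
    fun h4 => ?_, fun h4 => ⟨?_, hthree⟩⟩
  · ext j
    exact hhigh j (by lia)
  · rw [degree_le_iff_coeff_zero]
    intro j hj
    have : d - 5 < j := by exact_mod_cast hj
    exact hhigh j (by lia)
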